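/- Let N ≥ 1 and j ≥ 1. The map E_j is infinitely differentiable (C^∞), and for every x : Fin N → ℝ the Fréchet derivative fderiv ℝ E_j x : (Fin N → ℝ) →L[ℝ] (D(N,j) → ℝ) is injective; in particular its range is an N-dimensional subspace of D(N,j) → ℝ. -/

import Mathlib

/-- The index set of nonconstant monomials of degree between 1 and `j` in `N` variables. -/
def Dset (N j : ℕ) : Set (Fin N →₀ ℕ) := {d | 1 ≤ ∑ i, d i ∧ ∑ i, d i ≤ j}

/-- The overparameterized monomial map `E_j`, sending `x` to the vector of all
nonconstant monomials of degree at most `j` evaluated at `x`. -/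
noncomputable def Emap (N j : ℕ) (x : Fin N → ℝ) : Dset N j → ℝ :=
  fun d => ∏ i, x i ^ ((d : Fin N →₀ ℕ) i)

theorem single_mem_Dset (N j : ℕ) (hj : 1 ≤ j) (i : Fin N) :
    (Finsupp.single i 1 : Fin N →₀ ℕ) ∈ Dset N j := by
  have h : ∑ k, (Finsupp.single i 1 : Fin N →₀ ℕ) k = 1 := by
    simp [Finsupp.single_apply]
  exact ⟨by rw [h], by rw [h]; exact hj⟩

instance DsetFinite (N j : ℕ) : Finite (Dset N j) := by
  refine Finite.of_injective
    (fun d : Dset N j => (fun i => (⟨(d : Fin N →₀ ℕ) i,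
      Nat.lt_succ_of_le (le_trans
        (Finset.single_le_sum (fun k _ => Nat.zero_le ((d : Fin N →₀ ℕ) k)) (Finset.mem_univ i))
        d.2.2)⟩ : Fin (j + 1))) : Dset N j → (Fin N → Fin (j + 1))) ?_
  intro d e h
  apply Subtype.ext
  apply Finsupp.ext
  intro i
  simpa using congrFun h i

noncomputable instance (N j : ℕ) : Fintype (Dset N j) := Fintype.ofFinite _

theorem contDiff_Emap (N j : ℕ) {n : WithTop ℕ∞} : ContDiff ℝ n (Emap N j) := by
  unfold Emap
  fun_prop

/-- The coordinates of `Emap N j x` at the monomials of degree one recover `x`. -/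
theorem Emap_single {N j : ℕ} (hj : 1 ≤ j) (x : Fin N → ℝ) (i : Fin N) :
    Emap N j x ⟨Finsupp.single i 1, single_mem_Dset N j hj i⟩ = x i := by
  simp only [Emap]
  rw [Finset.prod_eq_single i] <;> simp +contextual [eq_comm]

theorem fderiv_Emap_single {N j : ℕ} (hj : 1 ≤ j) (x v : Fin N → ℝ) (i : Fin N) :
    fderiv ℝ (Emap N j) x v ⟨Finsupp.single i 1, single_mem_Dset N j hj i⟩ = v i := by
  have hd : HasFDerivAt (Emap N j) (fderiv ℝ (Emap N j) x) x :=
    ((contDiff_Emap N j (n := 1)).differentiable one_ne_zero x).hasFDerivAt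
  have h := hasFDerivAt_pi'.1 hd ⟨Finsupp.single i 1, single_mem_Dset N j hj i⟩
  simp only [Emap_single hj] at h
  exact congrArg (fun L : (Fin N → ℝ) →L[ℝ] ℝ => L v) (h.unique (hasFDerivAt_apply i x))

theorem fderiv_Emap_injective {N j : ℕ} (hj : 1 ≤ j) (x : Fin N → ℝ) :
    Function.Injective (fderiv ℝ (Emap N j) x) := by
  intro v w h
  funext i
  rw [← fderiv_Emap_single hj x v i, h, fderiv_Emap_single hj x w i]

/-- The overparameterized monomial map `E_j` is infinitely differentiable, and at
every point its Fréchet derivative is injective; in particular the range of the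
derivative is an `N`-dimensional subspace of `ℝ^{D(N,j)}`. -/
theorem Emap_contDiff_and_fderiv_injective (N j : ℕ) (hN : 1 ≤ N) (hj : 1 ≤ j) :
    ContDiff ℝ (⊤ : ℕ∞) (Emap N j) ∧
      ∀ x : Fin N → ℝ,
        Function.Injective (fderiv ℝ (Emap N j) x) ∧
        Module.finrank ℝ
          (LinearMap.range ((fderiv ℝ (Emap N j) x) : (Fin N → ℝ) →ₗ[ℝ] (Dset N j → ℝ))) = N := by
  refine ⟨contDiff_Emap N j, fun x => ⟨fderiv_Emap_injective hj x, ?_⟩⟩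
  rw [LinearMap.finrank_range_of_inj (fderiv_Emap_injective hj x), Module.finrank_fin_fun]
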